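/- Suppose the linear program (P) has a finite optimal value, let x̄ be an optimal solution of (P) and let π̄ be an optimal solution of the dual (D). Then for every penalty vector v ∈ ℝⁿ with v ≥ x̄ componentwise, the pair (π, ζ) = (π̄, 0) is an optimal solution of the penalized dual problem (D_v). -/

import Mathlib

open Matrix

theorem farkas_aux {V ι : Type*} [AddCommGroup V] [Module ℝ V] [DecidableEq ι] (s : Finset ι) :
    ∀ (a : ι → V →ₗ[ℝ] ℝ) (b : V →ₗ[ℝ] ℝ),
      (∀ x, (∀ i ∈ s, a i x ≤ 0) → b x ≤ 0) →
      ∃ y : ι → ℝ, (∀ i, 0 ≤ y i) ∧ ∀ x, b x = ∑ i ∈ s, y i * a i x := by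
  induction s using Finset.induction_on with
  | empty =>
    intro a b h
    refine ⟨fun _ => 0, fun _ => le_rfl, fun x => ?_⟩
    have h1 := h x (by simp)
    have h2 := h (-x) (by simp)
    rw [map_neg] at h2
    simp only [Finset.sum_empty]
    linarith
  | insert k t hk ih =>
    intro a b h
    by_cases hb : ∀ x, (∀ i ∈ t, a i x ≤ 0) → b x ≤ 0
    · obtain ⟨y, hy, hyb⟩ := ih a b hb
      refine ⟨fun i => if i = k then 0 else y i, fun i => ?_, fun x => ?_⟩
      · dsimp only
        split_ifs
        · exact le_rfl
        · exact hy i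
      · rw [Finset.sum_insert hk, hyb x]
        simp only [if_true, zero_mul, zero_add]
        refine Finset.sum_congr rfl fun i hi => ?_
        rw [if_neg (ne_of_mem_of_not_mem hi hk)]
    · push Not at hb
      obtain ⟨z, hz, hbz⟩ := hb
      have hkz : 0 < a k z := by
        by_contra hcon
        push Not at hcon
        have := h z (fun i hi => by
          rcases Finset.mem_insert.1 hi with rfl | hi
          · exact hcon
          · exact hz i hi)
        linarith
      have key : ∀ (f : V →ₗ[ℝ] ℝ) x, (f - (f z / a k z) • a k) x
          = f (x - (a k x / a k z) • z) := by
        intro f x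
        simp only [LinearMap.sub_apply, LinearMap.smul_apply, smul_eq_mul, map_sub, map_smul]
        ring
      obtain ⟨y, hy, hyb⟩ := ih (fun i => a i - (a i z / a k z) • a k)
        (b - (b z / a k z) • a k) (fun x hx => by
          rw [key]
          apply h
          intro i hi
          rcases Finset.mem_insert.1 hi with rfl | hi
          · simp only [map_sub, map_smul, smul_eq_mul]
            rw [div_mul_cancel₀ _ hkz.ne', sub_self]
          · rw [← key]; exact hx i hi)
      have hsum : ∑ i ∈ t, y i * a i z ≤ 0 :=
        Finset.sum_nonpos fun i hi => mul_nonpos_of_nonneg_of_nonpos (hy i) (hz i hi)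
      refine ⟨fun i => if i = k then (b z - ∑ i ∈ t, y i * a i z) / a k z else y i,
        fun i => ?_, fun x => ?_⟩
      · dsimp only
        split_ifs
        · apply div_nonneg _ hkz.le
          linarith
        · exact hy i
      · have h1 := hyb x
        simp only [LinearMap.sub_apply, LinearMap.smul_apply, smul_eq_mul] at h1
        rw [Finset.sum_insert hk]
        have h2 : ∑ i ∈ t, (if i = k then (b z - ∑ i ∈ t, y i * a i z) / a k z else y i) * a i x
            = ∑ i ∈ t, y i * a i x :=
          Finset.sum_congr rfl fun i hi => by rw [if_neg (ne_of_mem_of_not_mem hi hk)]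
        have h3 : ∑ i ∈ t, y i * (a i x - a i z / a k z * a k x)
            = ∑ i ∈ t, y i * a i x - (∑ i ∈ t, y i * a i z) / a k z * a k x := by
          rw [Finset.sum_div, Finset.sum_mul, ← Finset.sum_sub_distrib]
          exact Finset.sum_congr rfl fun i _ => by ring
        rw [h2]
        simp only [if_true]
        rw [h3] at h1
        rw [sub_div, sub_mul]
        linarith

/-- If `x̄` is an optimal solution of the primal `min c·x s.t. Ax = b, x ≥ 0`
and `π̄` is an optimal solution of the dual `max b·π s.t. Aᵀπ ≤ c`, then for
every penalty vector `v ≥ x̄` the pair `(π̄, 0)` is an optimal solution of the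
penalized dual `max b·π − v·ζ s.t. Aᵀπ ≤ c + ζ, ζ ≥ 0`. -/
theorem penalized_dual_optimal_solution {m n : ℕ}
    (A : Matrix (Fin m) (Fin n) ℝ) (b : Fin m → ℝ) (c : Fin n → ℝ)
    (xbar : Fin n → ℝ)
    (hxbar_feas : A.mulVec xbar = b ∧ 0 ≤ xbar)
    (hxbar_opt : ∀ x : Fin n → ℝ, A.mulVec x = b → 0 ≤ x → c ⬝ᵥ xbar ≤ c ⬝ᵥ x)
    (pibar : Fin m → ℝ)
    (hpibar_feas : Aᵀ.mulVec pibar ≤ c)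
    (hpibar_opt : ∀ π : Fin m → ℝ, Aᵀ.mulVec π ≤ c → b ⬝ᵥ π ≤ b ⬝ᵥ pibar)
    (v : Fin n → ℝ) (hv : xbar ≤ v) :
    IsGreatest {w : ℝ | ∃ π : Fin m → ℝ, ∃ ζ : Fin n → ℝ,
        Aᵀ.mulVec π ≤ c + ζ ∧ 0 ≤ ζ ∧ w = b ⬝ᵥ π - v ⬝ᵥ ζ}
      (b ⬝ᵥ pibar - v ⬝ᵥ (0 : Fin n → ℝ)) := by
  obtain ⟨hAx, hx0⟩ := hxbar_feas
  have strong : c ⬝ᵥ xbar ≤ b ⬝ᵥ pibar := by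
    classical
    let J : Finset (Fin n) := Finset.univ.filter fun j => (Aᵀ.mulVec pibar) j = c j
    let a : Fin n → (Fin m → ℝ) →ₗ[ℝ] ℝ := fun j => (LinearMap.proj j).comp Aᵀ.mulVecLin
    let bl : (Fin m → ℝ) →ₗ[ℝ] ℝ := dotProductBilin ℝ ℝ b
    have ha : ∀ j d, a j d = (Aᵀ.mulVec d) j := fun j d => rfl
    have hbl : ∀ d, bl d = b ⬝ᵥ d := fun d => rfl
    obtain ⟨y, hy, hyb⟩ := farkas_aux J a bl (by
      intro d hd
      have hev : ∀ᶠ e : ℝ in nhdsWithin 0 (Set.Ioi 0),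
          ∀ j, (Aᵀ.mulVec pibar) j + e * (Aᵀ.mulVec d) j ≤ c j := by
        rw [Filter.eventually_all]
        intro j
        by_cases hj : (Aᵀ.mulVec pibar) j = c j
        · filter_upwards [self_mem_nhdsWithin] with e he
          have h1 := hd j (by simp [J, hj])
          rw [ha] at h1
          have h2 := mul_nonpos_of_nonneg_of_nonpos (le_of_lt he) h1
          linarith
        · have hlt := lt_of_le_of_ne (hpibar_feas j) hj
          have hc : Continuous fun e : ℝ => (Aᵀ.mulVec pibar) j + e * (Aᵀ.mulVec d) j := by
            fun_prop
          have := hc.continuousAt (x := 0)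
          have h3 := this.eventually_lt (continuousAt_const (y := c j)) (by simpa using hlt)
          exact (h3.filter_mono nhdsWithin_le_nhds).mono fun e he => he.le
      obtain ⟨e, he, hpos⟩ := (hev.and self_mem_nhdsWithin).exists
      have hpos' : 0 < e := hpos
      have h4 := hpibar_opt (pibar + e • d) (fun j => by
        rw [mulVec_add, mulVec_smul]; exact he j)
      rw [dotProduct_add, dotProduct_smul, smul_eq_mul] at h4
      rw [hbl]
      by_contra hcon
      push Not at hcon
      have := mul_pos hpos' hcon
      linarith)
    let y' : Fin n → ℝ := fun j => if j ∈ J then y j else 0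
    have hy' : ∀ d, b ⬝ᵥ d = y' ⬝ᵥ Aᵀ.mulVec d := by
      intro d
      rw [← hbl, hyb]
      simp only [dotProduct, y', ite_mul, zero_mul, Finset.sum_ite_mem, Finset.univ_inter, ha]
    have hAy : A.mulVec y' = b := by
      apply dotProduct_eq
      intro d
      rw [hy', dotProduct_mulVec, vecMul_transpose]
    have hopt := hxbar_opt y' hAy (fun j => by
      simp only [y', Pi.zero_apply]
      split_ifs
      · exact hy j
      · exact le_rfl)
    refine hopt.trans (le_of_eq ?_)
    rw [hy', dotProduct_comm]
    refine Finset.sum_congr rfl fun j _ => ?_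
    by_cases hj : j ∈ J
    · rw [(Finset.mem_filter.1 hj).2]
    · simp [y', hj]
  refine ⟨⟨pibar, 0, by simpa using hpibar_feas, le_rfl, rfl⟩, ?_⟩
  rintro w ⟨p, z, hp, hz, rfl⟩
  have h1 : b ⬝ᵥ p = xbar ⬝ᵥ Aᵀ.mulVec p := by
    rw [dotProduct_mulVec, vecMul_transpose, hAx]
  have h2 : xbar ⬝ᵥ Aᵀ.mulVec p ≤ xbar ⬝ᵥ (c + z) :=
    dotProduct_le_dotProduct_of_nonneg_left hp hx0
  have h3 : xbar ⬝ᵥ z ≤ v ⬝ᵥ z := dotProduct_le_dotProduct_of_nonneg_right hv hz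
  rw [dotProduct_add, dotProduct_comm xbar c] at h2
  rw [dotProduct_zero]
  linarith
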